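/- (Theorem 2: adaptive consensus of second-order agents with unknown non-identical control directions.) Let N ≥ 2 agents have dynamics ẋ_i = v_i, v̇_i = b_i u_i + θ_i^T φ_i(x_i, v_i), i = 1,...,N, where each b_i ∈ ℝ is nonzero, θ_i ∈ ℝ^{ℓ_i}, and φ_i : ℝ×ℝ → ℝ^{ℓ_i} is smooth. Let a_{ij} ≥ 0 be adjacency weights with a_{ii} = 0, let L be the associated graph Laplacian (L_{ii} = Σ_{j≠i} a_{ij}, L_{ij} = −a_{ij} for j ≠ i), and assume L satisfies the Laplacian decomposition hypotheses with data (ω, U, V, D). Fix ρ, ν, λ > 0, γ_i > 0, x̄ ∈ ℝ^N, let N(ζ) := ζ² cos(ζ), define z_i(t) := x_i(t) − x̄_i + ρ ∫₀ᵗ ξ_i(s) ds where ξ_i := Σ_j a_{ij}(x_i − x_j), and the filtered error s_i := v_i + ρ ξ_i + λ z_i. Suppose x_i, v_i : [0,∞) → ℝ, θ̂_i : [0,∞) → ℝ^{ℓ_i}, ζ_i : [0,∞) → ℝ are continuously differentiable and satisfy for all t ≥ 0 the closed-loop equations ẋ_i = v_i, v̇_i = b_i u_i + θ_i^T φ_i(x_i,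 v_i), u_i = N(ζ_i)[θ̂_i^T φ_i(x_i,v_i) + λ v_i + ρ Σ_j a_{ij}(v_i − v_j) + ν s_i + λρ Σ_j a_{ij}(x_i − x_j)], θ̂'_i = γ_i φ_i(x_i,v_i) s_i, and ζ'_i = ν s_i² + s_i [θ̂_i^T φ_i(x_i,v_i) + λ v_i + ρ Σ_j a_{ij}(v_i − v_j) + λρ Σ_j a_{ij}(x_i − x_j)]. Then all signals x_i, v_i, z_i, s_i, θ̂_i, ζ_i, u_i are bounded on [0,∞), lim_{t→∞}(x_i(t) − x_j(t)) = 0 and lim_{t→∞}(v_i(t) − v_j(t)) = 0 for all i, j, and lim_{t→∞} x_i(t) = Σ_{j=1}^N ω_j x̄_j with lim_{t→∞} v_i(t) = 0 for every i. -/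

import Mathlib

open Matrix Filter
open scoped Matrix

noncomputable section

/-- Laplacian decomposition hypotheses for an `N × N` real matrix `L` (`N ≥ 2`), with data
`(ω, U, V, D)`: `ω ∈ ℝ^N` has positive entries summing to `1`; `U, V ∈ ℂ^{N×(N-1)}`;
`D ∈ ℂ^{(N-1)×(N-1)}` is upper triangular with all diagonal entries of positive real part;
and, viewing `L` as a complex matrix, `L = U D Vᵀ`, `Vᵀ U = I`, `Vᵀ 1 = 0`, `ωᵀ U = 0`,
`ωᵀ 1 = 1`, and `U Vᵀ + 1 ωᵀ = I`. -/
structure LapDecomp (N : ℕ) (L : Matrix (Fin N) (Fin N) ℝ) (ω : Fin N → ℝ)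
    (U V : Matrix (Fin N) (Fin (N - 1)) ℂ)
    (D : Matrix (Fin (N - 1)) (Fin (N - 1)) ℂ) : Prop where
  two_le : 2 ≤ N
  omega_pos : ∀ i, 0 < ω i
  omega_sum : ∑ i, ω i = 1
  D_upper : ∀ i j : Fin (N - 1), j < i → D i j = 0
  D_diag_pos : ∀ i, 0 < (D i i).re
  L_eq : L.map Complex.ofReal = U * D * Vᵀ
  VtU : Vᵀ * U = 1
  Vt_one : Vᵀ *ᵥ (fun _ => (1 : ℂ)) = 0
  omega_U : (fun i => (ω i : ℂ)) ᵥ* U = 0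
  UVt : U * Vᵀ + Matrix.of (fun _ j => (ω j : ℂ)) = 1

def Bdd0 {E : Type*} [NormedRing E] (f : ℝ → E) : Prop := ∃ M : ℝ, ∀ t : ℝ, 0 ≤ t → ‖f t‖ ≤ M

lemma Bdd0.const {E : Type*} [NormedRing E] (c : E) : Bdd0 (fun _ => c) := ⟨‖c‖, fun _ _ => le_rfl⟩

lemma Bdd0.add {E : Type*} [NormedRing E] {f g : ℝ → E} (hf : Bdd0 f) (hg : Bdd0 g) :
    Bdd0 (fun t => f t + g t) := by
  obtain ⟨A, hA⟩ := hf
  obtain ⟨B, hB⟩ := hg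
  exact ⟨A + B, fun t ht => (norm_add_le _ _).trans (add_le_add (hA t ht) (hB t ht))⟩

lemma Bdd0.neg {E : Type*} [NormedRing E] {f : ℝ → E} (hf : Bdd0 f) : Bdd0 (fun t => - f t) := by
  obtain ⟨A, hA⟩ := hf
  exact ⟨A, fun t ht => by rw [norm_neg]; exact hA t ht⟩

lemma Bdd0.sub {E : Type*} [NormedRing E] {f g : ℝ → E} (hf : Bdd0 f) (hg : Bdd0 g) :
    Bdd0 (fun t => f t - g t) := by
  simpa [sub_eq_add_neg] using hf.add hg.neg

lemma Bdd0.mul {E : Type*} [NormedRing E] {f g : ℝ → E} (hf : Bdd0 f) (hg : Bdd0 g) :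
    Bdd0 (fun t => f t * g t) := by
  obtain ⟨A, hA⟩ := hf
  obtain ⟨B, hB⟩ := hg
  exact ⟨A * B, fun t ht => (norm_mul_le _ _).trans
    (mul_le_mul (hA t ht) (hB t ht) (norm_nonneg _) ((norm_nonneg _).trans (hA t ht)))⟩

lemma Bdd0.sum {E ι : Type*} [NormedRing E] (s : Finset ι) {f : ι → ℝ → E}
    (hf : ∀ i ∈ s, Bdd0 (f i)) : Bdd0 (fun t => ∑ i ∈ s, f i t) := by
  have : ∀ i, ∃ M : ℝ, i ∈ s → ∀ t : ℝ, 0 ≤ t → ‖f i t‖ ≤ M := by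
    intro i
    by_cases h : i ∈ s
    · obtain ⟨M, hM⟩ := hf i h
      exact ⟨M, fun _ => hM⟩
    · exact ⟨0, fun h' => absurd h' h⟩
  choose M hM using this
  exact ⟨∑ i ∈ s, M i, fun t ht => (norm_sum_le _ _).trans
    (Finset.sum_le_sum fun i hi => hM i hi t ht)⟩

/-- scalar comparison -/
lemma comparison_aux {W W' : ℝ → ℝ} {c G T : ℝ} (hc : 0 < c)
    (hW : ∀ t, T ≤ t → HasDerivAt W (W' t) t)
    (hle : ∀ t, T ≤ t → W' t ≤ -c * W t + G) :
    ∀ t, T ≤ t → W t ≤ G / c + (W T - G / c) * Real.exp (c * (T - t)) := by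
  intro t ht
  have hd : ∀ r, T ≤ r → HasDerivAt (fun r => (W r - G / c) * Real.exp (c * r))
      (W' r * Real.exp (c * r) + (W r - G / c) * (Real.exp (c * r) * (c * 1))) r := by
    intro r hr
    exact ((hW r hr).sub_const _).mul (((hasDerivAt_id r).const_mul c).exp)
  have hanti : AntitoneOn (fun r => (W r - G / c) * Real.exp (c * r)) (Set.Ici T) := by
    apply antitoneOn_of_deriv_nonpos (convex_Ici T)
    · intro r hr
      exact (hd r hr).continuousAt.continuousWithinAt
    · intro r hr
      rw [interior_Ici] at hr
      exact (hd r (le_of_lt hr)).differentiableAt.differentiableWithinAt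
    · intro r hr
      rw [interior_Ici] at hr
      rw [(hd r (le_of_lt hr)).deriv]
      have h1 := hle r (le_of_lt hr)
      have h2 := Real.exp_pos (c * r)
      have : W' r * Real.exp (c * r) + (W r - G / c) * (Real.exp (c * r) * (c * 1))
          = (W' r + c * W r - G) * Real.exp (c * r) := by
        field_simp
        ring
      rw [this]
      exact mul_nonpos_of_nonpos_of_nonneg (by linarith) h2.le
  have h := hanti (Set.mem_Ici.2 le_rfl) (Set.mem_Ici.2 ht) ht
  simp only at h
  have h2 := Real.exp_pos (c * t)
  have he : Real.exp (c * (T - t)) * Real.exp (c * t) = Real.exp (c * T) := by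
    rw [← Real.exp_add]; ring_nf
  have : (W t - G / c) ≤ (W T - G / c) * Real.exp (c * (T - t)) := by
    have : (W t - G / c) * Real.exp (c * t) ≤
        ((W T - G / c) * Real.exp (c * (T - t))) * Real.exp (c * t) := by
      rw [mul_assoc, he]; exact h
    exact le_of_mul_le_mul_right this h2
  linarith

lemma ode_energy {y f : ℝ → ℂ} {c : ℂ} (hc : 0 < c.re) {T B : ℝ} 
    (hy : ∀ t, T ≤ t → HasDerivAt y (-c * y t + f t) t)
    (hf : ∀ t, T ≤ t → ‖f t‖ ≤ B) :
    ∀ t, T ≤ t → ‖y t‖ ^ 2 ≤ (B / c.re) ^ 2 + ‖y T‖ ^ 2 * Real.exp (c.re * (T - t)) := by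
  intro t ht
  have hre : ∀ r, T ≤ r → HasDerivAt (fun r => (y r).re) (-c * y r + f r).re r := fun r hr =>
    Complex.reCLM.hasFDerivAt.comp_hasDerivAt r (hy r hr)
  have him : ∀ r, T ≤ r → HasDerivAt (fun r => (y r).im) (-c * y r + f r).im r := fun r hr =>
    Complex.imCLM.hasFDerivAt.comp_hasDerivAt r (hy r hr)
  have hn : ∀ w : ℂ, ‖w‖ ^ 2 = w.re ^ 2 + w.im ^ 2 := by
    intro w; rw [Complex.sq_norm, Complex.normSq_apply]; ring
  have hW : ∀ r, T ≤ r → HasDerivAt (fun r => ‖y r‖ ^ 2)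
      (2 * (y r).re * (-c * y r + f r).re + 2 * (y r).im * (-c * y r + f r).im) r := by
    intro r hr
    simp only [hn]
    refine (((hre r hr).pow 2).add ((him r hr).pow 2)).congr_deriv ?_
    simp
  have := comparison_aux (G := B ^ 2 / c.re) hc hW (by
    intro r hr
    have hfB : ‖f r‖ ^ 2 ≤ B ^ 2 := by
      have := hf r hr
      gcongr
    rw [hn] at hfB
    rw [hn]
    simp only [Complex.add_re, Complex.add_im, Complex.mul_re, Complex.mul_im, Complex.neg_re,
      Complex.neg_im]
    have h3 : ((f r).re ^ 2 + (f r).im ^ 2) / c.re ≤ B ^ 2 / c.re := by gcongr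
    have h4 : ∀ p q : ℝ, 2 * p * q ≤ c.re * p ^ 2 + q ^ 2 / c.re := by
      intro p q
      have : c.re * p ^ 2 + q ^ 2 / c.re - 2 * p * q = (c.re * p - q) ^ 2 / c.re := by
        field_simp; ring
      have h5 : 0 ≤ (c.re * p - q) ^ 2 / c.re := by positivity
      linarith
    have h6 := h4 (y r).re (f r).re
    have h7 := h4 (y r).im (f r).im
    rw [add_div] at h3
    nlinarith) t ht
  have e1 : B ^ 2 / c.re / c.re = (B / c.re) ^ 2 := by field_simp
  rw [e1] at this
  have h2 := Real.exp_pos (c.re * (T - t))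
  have h3 : 0 ≤ (B / c.re) ^ 2 * Real.exp (c.re * (T - t)) := by positivity
  linarith

lemma ode_bdd {y f : ℝ → ℂ} {c : ℂ} (hc : 0 < c.re)
    (hy : ∀ t, 0 ≤ t → HasDerivAt y (-c * y t + f t) t) (hf : Bdd0 f) : Bdd0 y := by
  obtain ⟨B, hB⟩ := hf
  refine ⟨Real.sqrt ((B / c.re) ^ 2 + ‖y 0‖ ^ 2), fun t ht => ?_⟩
  apply Real.le_sqrt_of_sq_le
  have h := ode_energy hc hy hB t ht
  have : Real.exp (c.re * (0 - t)) ≤ 1 := by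
    rw [Real.exp_le_one_iff]; nlinarith
  have h2 : ‖y 0‖ ^ 2 * Real.exp (c.re * (0 - t)) ≤ ‖y 0‖ ^ 2 * 1 := by gcongr
  linarith

lemma ode_tendsto {y f : ℝ → ℂ} {c : ℂ} (hc : 0 < c.re)
    (hy : ∀ t, 0 ≤ t → HasDerivAt y (-c * y t + f t) t)
    (hf : Tendsto f atTop (nhds 0)) : Tendsto y atTop (nhds 0) := by
  rw [Metric.tendsto_atTop]
  intro ε hε
  rw [Metric.tendsto_atTop] at hf
  obtain ⟨T0, hT0⟩ := hf (c.re * ε / 2) (by positivity)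
  set T := max T0 0 with hT
  have h := ode_energy (y := y) (f := f) (T := T) (B := c.re * ε / 2) hc
    (fun t ht => hy t ((le_max_right _ _).trans ht))
    (fun t ht => by
      have := hT0 t ((le_max_left _ _).trans ht)
      rw [dist_zero_right] at this
      exact this.le)
  have hlim : Tendsto (fun t : ℝ => ‖y T‖ ^ 2 * Real.exp (c.re * (T - t))) atTop (nhds 0) := by
    rw [show (0:ℝ) = ‖y T‖ ^ 2 * 0 by simp]
    apply Tendsto.const_mul
    apply Real.tendsto_exp_atBot.comp
    apply Tendsto.const_mul_atBot hc
    exact tendsto_atBot_add_const_left _ T tendsto_neg_atTop_atBot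
  have hev := hlim.eventually_lt_const (show 0 < ε ^ 2 / 2 by positivity)
  obtain ⟨T1, hT1⟩ := eventually_atTop.1 hev
  refine ⟨max T T1, fun t ht => ?_⟩
  rw [dist_zero_right]
  have h1 := h t ((le_max_left _ _).trans ht)
  have h2 := hT1 t ((le_max_right _ _).trans ht)
  have h3 : (c.re * ε / 2 / c.re) ^ 2 = ε ^ 2 / 4 := by field_simp; norm_num
  rw [h3] at h1
  apply lt_of_pow_lt_pow_left₀ 2 hε.le
  nlinarith

lemma tri_bdd {n : ℕ} {D : Matrix (Fin n) (Fin n) ℂ} (hup : ∀ i j : Fin n, j < i → D i j = 0)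
    (hD : ∀ i, 0 < (D i i).re) {y f : Fin n → ℝ → ℂ}
    (hy : ∀ i, ∀ t, 0 ≤ t → HasDerivAt (y i) (-(∑ j, D i j * y j t) + f i t) t) :
    ((∀ i, Bdd0 (f i)) → ∀ i, Bdd0 (y i)) ∧
    ((∀ i, Tendsto (f i) atTop (nhds 0)) → ∀ i, Tendsto (y i) atTop (nhds 0)) := by
  have key : ∀ i, ∀ t, 0 ≤ t → HasDerivAt (y i)
      (-(D i i) * y i t + (f i t - ∑ j ∈ Finset.univ.filter (fun j => i < j), D i j * y j t)) t := by
    intro i t ht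
    convert hy i t ht using 1
    have : ∑ j, D i j * y j t = D i i * y i t +
        ∑ j ∈ Finset.univ.filter (fun j => i < j), D i j * y j t := by
      rw [← Finset.add_sum_erase _ _ (Finset.mem_univ i)]
      congr 1
      symm
      apply Finset.sum_subset
      · intro j hj
        simp at hj
        simp [hj.ne']
      · intro j hj hj2
        simp at hj hj2
        rw [hup i j (lt_of_le_of_ne hj2 hj), zero_mul]
    rw [this]; ring
  constructor
  · intro hf i
    induction i using WellFoundedGT.induction with
    | ind i ih =>
      refine ode_bdd (hD i) (key i) ((hf i).sub (Bdd0.sum _ fun j hj => ?_))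
      simp at hj
      exact (Bdd0.const _).mul (ih j hj)
  · intro hf i
    induction i using WellFoundedGT.induction with
    | ind i ih =>
      refine ode_tendsto (hD i) (key i) ?_
      rw [show (0:ℂ) = 0 - ∑ j ∈ Finset.univ.filter (fun j => i < j), D i j * 0 by simp]
      refine (hf i).sub (tendsto_finsetSum _ fun j hj => ?_)
      simp at hj
      exact (ih j hj).const_mul _

lemma barbalat_aux {F g : ℝ → ℝ} {K l : ℝ} (hF : ∀ t, 0 ≤ t → HasDerivAt F (g t) t)
    (hg : ∀ p q, 0 ≤ p → p ≤ q → |g p - g q| ≤ K * (q - p))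
    (hl : Tendsto F atTop (nhds l)) : Tendsto g atTop (nhds 0) := by
  rw [Metric.tendsto_atTop]
  intro ε hε
  set K' := |K| + 1
  have hK' : 0 < K' := by positivity
  have hKK : K ≤ K' := (le_abs_self K).trans (by simp [K'])
  set δ := ε / (2 * K')
  have hδ : 0 < δ := by positivity
  have hdiff : Tendsto (fun t => F (t + δ) - F t) atTop (nhds 0) := by
    rw [show (0:ℝ) = l - l by simp]
    exact (hl.comp (tendsto_atTop_add_const_right _ δ tendsto_id)).sub hl
  rw [Metric.tendsto_atTop] at hdiff
  obtain ⟨T, hT⟩ := hdiff (δ * (ε / 2)) (by positivity)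
  refine ⟨max T 0, fun t ht => ?_⟩
  have ht0 : 0 ≤ t := (le_max_right _ _).trans ht
  have h1 := hT t ((le_max_left _ _).trans ht)
  rw [dist_zero_right, Real.norm_eq_abs] at *
  obtain ⟨c, hc, hceq⟩ := exists_hasDerivAt_eq_slope F g (show t < t + δ by linarith)
    (fun r hr => (hF r (ht0.trans hr.1)).continuousAt.continuousWithinAt)
    (fun r hr => hF r (ht0.trans hr.1.le))
  have h2 := hg t c ht0 hc.1.le
  have h3 : K * (c - t) ≤ K' * δ :=
    mul_le_mul hKK (by linarith [hc.2]) (by linarith [hc.1]) hK'.le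
  have h4 : K' * δ = ε / 2 := by simp only [δ]; field_simp
  have h5 : |g c| < ε / 2 := by
    rw [hceq, add_sub_cancel_left, abs_div, abs_of_pos hδ, div_lt_iff₀ hδ]
    linarith
  have h6 : |g t| ≤ |g t - g c| + |g c| := by
    have := abs_add_le (g t - g c) (g c)
    simpa using this
  linarith

def nG (b ζ : ℝ) : ℝ := b * (ζ ^ 2 * Real.sin ζ + 2 * ζ * Real.cos ζ - 2 * Real.sin ζ) + ζ

lemma nG_deriv (b ζ : ℝ) : HasDerivAt (nG b) (b * (ζ ^ 2 * Real.cos ζ) + 1) ζ := by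
  have h := ((((hasDerivAt_pow 2 ζ).mul (Real.hasDerivAt_sin ζ)).add
    (((hasDerivAt_id ζ).const_mul 2).mul (Real.hasDerivAt_cos ζ))).sub
    ((Real.hasDerivAt_sin ζ).const_mul 2)).const_mul b |>.add (hasDerivAt_id ζ)
  refine h.congr_deriv ?_
  simp only [id, Nat.cast_ofNat, Nat.add_one_sub_one, pow_one]
  ring

lemma exists_large_sin (R : ℝ) : (∃ P, R ≤ P ∧ Real.sin P = 1 ∧ Real.cos P = 0) ∧
    ∃ P, R ≤ P ∧ Real.sin P = -1 ∧ Real.cos P = 0 := by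
  obtain ⟨k, hk⟩ := exists_nat_ge (R + 2)
  have hpi := Real.pi_gt_three
  have hk0 : (0:ℝ) ≤ k := Nat.cast_nonneg k
  constructor
  · refine ⟨Real.pi / 2 + k * (2 * Real.pi), by nlinarith, ?_, ?_⟩
    · rw [Real.sin_add_nat_mul_two_pi, Real.sin_pi_div_two]
    · rw [Real.cos_add_nat_mul_two_pi, Real.cos_pi_div_two]
  · have hpi4 := Real.pi_le_four
    refine ⟨-(Real.pi / 2) + k * (2 * Real.pi), by nlinarith, ?_, ?_⟩
    · rw [Real.sin_add_nat_mul_two_pi, Real.sin_neg, Real.sin_pi_div_two]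
    · rw [Real.cos_add_nat_mul_two_pi, Real.cos_neg, Real.cos_pi_div_two]

lemma nussbaum_bdd {b C : ℝ} (hb : b ≠ 0) {ζ : ℝ → ℝ} (hζ : Continuous ζ)
    (h : ∀ t, 0 ≤ t → C ≤ nG b (ζ t)) : Bdd0 ζ := by
  have hb' : 0 < |b| := abs_pos.2 hb
  set R := |ζ 0| + 2 / |b| + 2 * |b| + |C| + 1 with hR
  have hest : ∀ P, R ≤ P → -|b| * (P ^ 2 - 2) + P < C := by
    intro P hP
    have h2 : 0 ≤ 2 / |b| := by positivity
    have h3 : 2 / |b| ≤ P := by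
      have := abs_nonneg (ζ 0); have := abs_nonneg C; linarith
    have h4 : 2 ≤ |b| * P := by
      rw [div_le_iff₀ hb'] at h3; linarith
    have hPp : 0 < P := by
      have := abs_nonneg (ζ 0); have := abs_nonneg C; linarith
    have := abs_nonneg (ζ 0)
    have := neg_abs_le C
    nlinarith
  have hup : ∃ P, R ≤ P ∧ nG b P < C := by
    rcases lt_or_gt_of_ne hb with hn | hp
    · obtain ⟨P, hP, h1, h2⟩ := (exists_large_sin R).1
      refine ⟨P, hP, ?_⟩
      have := hest P hP
      rw [abs_of_neg hn] at this
      unfold nG; rw [h1, h2]; linarith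
    · obtain ⟨P, hP, h1, h2⟩ := (exists_large_sin R).2
      refine ⟨P, hP, ?_⟩
      have := hest P hP
      rw [abs_of_pos hp] at this
      unfold nG; rw [h1, h2]; linarith
  have hRpos : 0 < R := by positivity
  have hdn : ∃ Q, R ≤ Q ∧ nG b (-Q) < C := by
    rcases lt_or_gt_of_ne hb with hn | hp
    · obtain ⟨P, hP, h1, h2⟩ := (exists_large_sin R).2
      refine ⟨P, hP, ?_⟩
      have := hest P hP
      rw [abs_of_neg hn] at this
      unfold nG; rw [Real.sin_neg, Real.cos_neg, h1, h2]; linarith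
    · obtain ⟨P, hP, h1, h2⟩ := (exists_large_sin R).1
      refine ⟨P, hP, ?_⟩
      have := hest P hP
      rw [abs_of_pos hp] at this
      unfold nG; rw [Real.sin_neg, Real.cos_neg, h1, h2]; linarith
  obtain ⟨P, hP, hPC⟩ := hup
  obtain ⟨Q, hQ, hQC⟩ := hdn
  have h0 : |ζ 0| < R := by
    have h2 : 0 ≤ 2 / |b| := by positivity
    have := abs_nonneg C; linarith
  rw [abs_lt] at h0
  have h1 : ∀ t, 0 ≤ t → ζ t < P := by
    intro t ht
    by_contra hcon
    push Not at hcon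
    obtain ⟨r, hr, hre⟩ := intermediate_value_Icc ht hζ.continuousOn
      (show P ∈ Set.Icc (ζ 0) (ζ t) from ⟨by linarith, hcon⟩)
    have := h r hr.1
    rw [hre] at this
    linarith
  have h2 : ∀ t, 0 ≤ t → -Q < ζ t := by
    intro t ht
    by_contra hcon
    push Not at hcon
    obtain ⟨r, hr, hre⟩ := intermediate_value_Icc' ht hζ.continuousOn
      (show -Q ∈ Set.Icc (ζ t) (ζ 0) from ⟨hcon, by linarith⟩)
    have := h r hr.1
    rw [hre] at this
    linarith
  refine ⟨P + Q, fun t ht => ?_⟩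
  rw [Real.norm_eq_abs, abs_le]
  constructor <;> linarith [h1 t ht, h2 t ht]

/-- single-agent analysis: everything bounded, and `ν s²` has a convergent antiderivative -/
lemma agent_aux {ℓ : ℕ} {b ν γ : ℝ} (hb : b ≠ 0) (hν : 0 < ν) (hγ : 0 < γ)
    {θ : Fin ℓ → ℝ} {Φ θh : ℝ → Fin ℓ → ℝ} {ζ s η : ℝ → ℝ} (hζc : Continuous ζ)
    (hs : ∀ t, 0 ≤ t → HasDerivAt s (b * ((ζ t) ^ 2 * Real.cos (ζ t) * (η t + ν * s t)) +
      ∑ p, θ p * Φ t p + (η t - ∑ p, θh t p * Φ t p)) t)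
    (hθ : ∀ t, 0 ≤ t → HasDerivAt θh (fun p => γ * Φ t p * s t) t)
    (hζ : ∀ t, 0 ≤ t → HasDerivAt ζ (ν * (s t) ^ 2 + s t * η t) t) :
    Bdd0 ζ ∧ Bdd0 s ∧ (∀ p, Bdd0 (fun t => θh t p)) ∧
    ∃ (F : ℝ → ℝ) (l : ℝ), (∀ t, 0 ≤ t → HasDerivAt F (ν * (s t) ^ 2) t) ∧
      Tendsto F atTop (nhds l) := by
  set Vf : ℝ → ℝ := fun t => s t ^ 2 / 2 + ∑ p, (θ p - θh t p) ^ 2 / (2 * γ) with hVf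
  set F : ℝ → ℝ := fun t => nG b (ζ t) - Vf t with hFdef
  have hθp : ∀ t, 0 ≤ t → ∀ p, HasDerivAt (fun t => θh t p) (γ * Φ t p * s t) t :=
    fun t ht => hasDerivAt_pi.1 (hθ t ht)
  have hF : ∀ t, 0 ≤ t → HasDerivAt F (ν * (s t) ^ 2) t := by
    intro t ht
    have h1 := (nG_deriv b (ζ t)).comp t (hζ t ht)
    have h2 := ((hs t ht).pow 2).div_const 2
    have h3 : HasDerivAt (fun t => ∑ p, (θ p - θh t p) ^ 2 / (2 * γ))
        (∑ p, -((θ p - θh t p) * Φ t p * s t)) t := by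
      apply HasDerivAt.fun_sum
      intro p _
      have := (((hθp t ht p).const_sub (θ p)).pow 2).div_const (2 * γ)
      refine this.congr_deriv ?_
      field_simp
      simp
      ring
    have h4 := h1.sub (h2.add h3)
    refine h4.congr_deriv ?_
    have h5 : ∑ p, -((θ p - θh t p) * Φ t p * s t) =
        -(s t * (∑ p, θ p * Φ t p - ∑ p, θh t p * Φ t p)) := by
      rw [← Finset.sum_sub_distrib, Finset.mul_sum, ← Finset.sum_neg_distrib]
      apply Finset.sum_congr rfl
      intro p _; ring
    rw [h5]
    simp
    ring
  have hmono : MonotoneOn F (Set.Ici 0) := by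
    apply monotoneOn_of_deriv_nonneg (convex_Ici 0)
    · intro r hr
      exact (hF r hr).continuousAt.continuousWithinAt
    · intro r hr
      rw [interior_Ici] at hr
      exact (hF r (le_of_lt hr)).differentiableAt.differentiableWithinAt
    · intro r hr
      rw [interior_Ici] at hr
      rw [(hF r (le_of_lt hr)).deriv]
      positivity
  have hV0 : ∀ t, 0 ≤ Vf t := by
    intro t; simp only [hVf]; positivity
  have hF0 : ∀ t, 0 ≤ t → F 0 ≤ F t := fun t ht => hmono (Set.mem_Ici.2 le_rfl) ht ht
  have hζb : Bdd0 ζ := by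
    refine nussbaum_bdd (C := F 0) hb hζc (fun t ht => ?_)
    have h1 := hF0 t ht
    have h2 := hV0 t
    have h3 : F t = nG b (ζ t) - Vf t := rfl
    linarith
  have hGb : ∃ B, ∀ t, 0 ≤ t → nG b (ζ t) ≤ B := by
    obtain ⟨M, hM⟩ := hζb
    have hc : ContinuousOn (nG b) (Set.Icc (-M) M) := fun r _ =>
      (nG_deriv b r).continuousAt.continuousWithinAt
    obtain ⟨B, hB⟩ := isCompact_Icc.exists_bound_of_continuousOn hc
    refine ⟨B, fun t ht => (le_abs_self _).trans (hB _ ?_)⟩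
    exact abs_le.1 (hM t ht)
  obtain ⟨B, hB⟩ := hGb
  have hVb : ∀ t, 0 ≤ t → Vf t ≤ B - F 0 := by
    intro t ht
    have h1 := hF0 t ht
    have h2 := hB t ht
    have h3 : F t = nG b (ζ t) - Vf t := rfl
    linarith
  refine ⟨hζb, ?_, ?_, F, ?_⟩
  · refine ⟨Real.sqrt (2 * (B - F 0)), fun t ht => ?_⟩
    apply Real.le_sqrt_of_sq_le
    rw [Real.norm_eq_abs, sq_abs]
    have h1 := hVb t ht
    have h2 : 0 ≤ ∑ p, (θ p - θh t p) ^ 2 / (2 * γ) := by positivity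
    simp only [hVf] at h1
    linarith
  · intro p
    have : Bdd0 (fun t => θ p - θh t p) := by
      refine ⟨Real.sqrt (2 * γ * (B - F 0)), fun t ht => ?_⟩
      apply Real.le_sqrt_of_sq_le
      rw [Real.norm_eq_abs, sq_abs]
      have h1 := hVb t ht
      have h2 : (θ p - θh t p) ^ 2 / (2 * γ) ≤ ∑ p, (θ p - θh t p) ^ 2 / (2 * γ) :=
        Finset.single_le_sum (f := fun p => (θ p - θh t p) ^ 2 / (2 * γ))
          (fun q _ => by positivity) (Finset.mem_univ p)
      have h3 : 0 ≤ s t ^ 2 / 2 := by positivity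
      simp only [hVf] at h1
      have h4 : (θ p - θh t p) ^ 2 / (2 * γ) ≤ B - F 0 := by linarith
      rw [div_le_iff₀ (by positivity)] at h4
      linarith
    simpa using (Bdd0.const (θ p)).sub this
  · have hub : ∀ t, 0 ≤ t → F t ≤ B := by
      intro t ht
      have h2 := hB t ht
      have h1 := hV0 t
      have h3 : F t = nG b (ζ t) - Vf t := rfl
      linarith
    have hmono' : Monotone (fun t => F (max t 0)) := fun p q hpq =>
      hmono (Set.mem_Ici.2 (le_max_right _ _)) (Set.mem_Ici.2 (le_max_right _ _))
        (max_le_max_right 0 hpq)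
    have hbdd : BddAbove (Set.range (fun t => F (max t 0))) := by
      refine ⟨B, ?_⟩
      rintro _ ⟨t, rfl⟩
      exact hub _ (le_max_right _ _)
    have ht := tendsto_atTop_ciSup hmono' hbdd
    refine ⟨_, hF, ht.congr' ?_⟩
    filter_upwards [eventually_ge_atTop 0] with t ht
    rw [max_eq_left ht]

/-- Theorem 2: adaptive consensus of `N ≥ 2` second-order nonlinear agents
`ẋ_i = v_i`, `v̇_i = b_i u_i + θ_iᵀ φ_i(x_i, v_i)` with unknown, non-identical control
directions, under the Nussbaum-gain distributed controller with PI consensus error variables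
`z_i t = x_i t − x̄_i + ρ ∫₀ᵗ ξ_i`, `ξ_i = Σ_j a_{ij}(x_i − x_j)`, and filtered errors
`s_i = v_i + ρ ξ_i + λ z_i`.  All closed-loop signals are bounded, positions and velocities
reach consensus, all positions converge to `Σ_j ω_j x̄_j` and all velocities to `0`. -/
theorem adaptive_consensus_second_order {N : ℕ} (ℓ : Fin N → ℕ)
    (b : Fin N → ℝ) (hb : ∀ i, b i ≠ 0)
    (θ : (i : Fin N) → Fin (ℓ i) → ℝ)
    (φ : (i : Fin N) → ℝ → ℝ → Fin (ℓ i) → ℝ)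
    (hφ : ∀ i, ContDiff ℝ (⊤ : ℕ∞) (fun q : ℝ × ℝ => φ i q.1 q.2))
    (a : Fin N → Fin N → ℝ) (ha : ∀ i j, 0 ≤ a i j) (hadiag : ∀ i, a i i = 0)
    (L : Matrix (Fin N) (Fin N) ℝ)
    (hLdef : ∀ i j, L i j = if i = j then ∑ p, a i p else -(a i j))
    (ω : Fin N → ℝ) (U V : Matrix (Fin N) (Fin (N - 1)) ℂ)
    (D : Matrix (Fin (N - 1)) (Fin (N - 1)) ℂ)
    (hLap : LapDecomp N L ω U V D)
    {ρ ν lam : ℝ} (hρ : 0 < ρ) (hν : 0 < ν) (hlam : 0 < lam)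
    (γ : Fin N → ℝ) (hγ : ∀ i, 0 < γ i)
    (xbar : Fin N → ℝ)
    (x v : Fin N → ℝ → ℝ) (θh : (i : Fin N) → ℝ → Fin (ℓ i) → ℝ)
    (ζ : Fin N → ℝ → ℝ) (u : Fin N → ℝ → ℝ)
    (ξ : Fin N → ℝ → ℝ) (z : Fin N → ℝ → ℝ) (sf : Fin N → ℝ → ℝ)
    (hξdef : ∀ i, ∀ t : ℝ, ξ i t = ∑ j, a i j * (x i t - x j t))
    (hzdef : ∀ i, ∀ t : ℝ, z i t = x i t - xbar i + ρ * ∫ s in (0:ℝ)..t, ξ i s)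
    (hsdef : ∀ i, ∀ t : ℝ, sf i t = v i t + ρ * ξ i t + lam * z i t)
    (hxc : ∀ i, Continuous (x i)) (hvc : ∀ i, Continuous (v i))
    (hθhc : ∀ i, Continuous (θh i)) (hζc : ∀ i, Continuous (ζ i))
    (hdyn1 : ∀ i, ∀ t : ℝ, 0 ≤ t → HasDerivAt (x i) (v i t) t)
    (hdyn2 : ∀ i, ∀ t : ℝ, 0 ≤ t →
      HasDerivAt (v i) (b i * u i t + ∑ p, θ i p * φ i (x i t) (v i t) p) t)
    (hctrl : ∀ i, ∀ t : ℝ, 0 ≤ t → u i t =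
      (ζ i t) ^ 2 * Real.cos (ζ i t) *
        (∑ p, θh i t p * φ i (x i t) (v i t) p + lam * v i t +
          ρ * ∑ j, a i j * (v i t - v j t) + ν * sf i t +
          lam * ρ * ∑ j, a i j * (x i t - x j t)))
    (hadapt : ∀ i, ∀ t : ℝ, 0 ≤ t →
      HasDerivAt (θh i) (fun p => γ i * φ i (x i t) (v i t) p * sf i t) t)
    (hnuss : ∀ i, ∀ t : ℝ, 0 ≤ t →
      HasDerivAt (ζ i) (ν * (sf i t) ^ 2 +
        sf i t * (∑ p, θh i t p * φ i (x i t) (v i t) p + lam * v i t +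
          ρ * ∑ j, a i j * (v i t - v j t) +
          lam * ρ * ∑ j, a i j * (x i t - x j t))) t) :
    (∃ M : ℝ, ∀ i, ∀ t : ℝ, 0 ≤ t →
      |x i t| ≤ M ∧ |v i t| ≤ M ∧ |z i t| ≤ M ∧ |sf i t| ≤ M ∧
        ‖θh i t‖ ≤ M ∧ |ζ i t| ≤ M ∧ |u i t| ≤ M) ∧
    (∀ i j : Fin N, Tendsto (fun t : ℝ => x i t - x j t) atTop (nhds 0)) ∧
    (∀ i j : Fin N, Tendsto (fun t : ℝ => v i t - v j t) atTop (nhds 0)) ∧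
    (∀ i : Fin N, Tendsto (fun t : ℝ => x i t) atTop (nhds (∑ j, ω j * xbar j))) ∧
    (∀ i : Fin N, Tendsto (fun t : ℝ => v i t) atTop (nhds 0)) := by
  have hξc : ∀ i, Continuous (ξ i) := by
    intro i
    have : ξ i = fun t => ∑ j, a i j * (x i t - x j t) := funext (hξdef i)
    rw [this]
    exact continuous_finsetSum _ fun j _ => continuous_const.mul ((hxc i).sub (hxc j))
  have hz' : ∀ i t, 0 ≤ t → HasDerivAt (z i) (v i t + ρ * ξ i t) t := by
    intro i t ht
    have h1 : HasDerivAt (fun t => ∫ s in (0:ℝ)..t, ξ i s) (ξ i t) t :=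
      (hξc i).integral_hasStrictDerivAt 0 t |>.hasDerivAt
    have h2 := ((hdyn1 i t ht).sub_const (xbar i)).add (h1.const_mul ρ)
    have h3 : z i = fun t => x i t - xbar i + ρ * ∫ s in (0:ℝ)..t, ξ i s := funext (hzdef i)
    rw [h3]
    exact h2
  have hξ' : ∀ i t, 0 ≤ t → HasDerivAt (ξ i) (∑ j, a i j * (v i t - v j t)) t := by
    intro i t ht
    have : ξ i = fun t => ∑ j, a i j * (x i t - x j t) := funext (hξdef i)
    rw [this]
    apply HasDerivAt.fun_sum
    intro j _
    exact ((hdyn1 i t ht).sub (hdyn1 j t ht)).const_mul _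
  have hs' : ∀ i t, 0 ≤ t → HasDerivAt (sf i) ((b i * u i t + ∑ p, θ i p * φ i (x i t) (v i t) p)
      + ρ * (∑ j, a i j * (v i t - v j t)) + lam * (v i t + ρ * ξ i t)) t := by
    intro i t ht
    have h3 : sf i = fun t => v i t + ρ * ξ i t + lam * z i t := funext (hsdef i)
    rw [h3]
    exact ((hdyn2 i t ht).add ((hξ' i t ht).const_mul ρ)).add ((hz' i t ht).const_mul lam)
  have hagent := fun i => agent_aux (hb i) hν (hγ i) (θ := θ i)
    (Φ := fun t => φ i (x i t) (v i t)) (θh := θh i) (ζ := ζ i) (s := sf i)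
    (η := fun t => ∑ p, θh i t p * φ i (x i t) (v i t) p + lam * v i t +
          ρ * ∑ j, a i j * (v i t - v j t) + lam * ρ * ∑ j, a i j * (x i t - x j t)) (hζc i)
    (by
      intro t ht
      refine (hs' i t ht).congr_deriv ?_
      rw [hctrl i t ht, hξdef i t]
      ring) (hadapt i) (hnuss i)
  have bζ : ∀ i, Bdd0 (ζ i) := fun i => (hagent i).1
  have bs : ∀ i, Bdd0 (sf i) := fun i => (hagent i).2.1
  have bθ : ∀ i p, Bdd0 (fun t => θh i t p) := fun i => (hagent i).2.2.1
  have hlamC : 0 < ((lam : ℂ)).re := by simpa using hlam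
  have castB : ∀ f : ℝ → ℝ, Bdd0 f → Bdd0 (fun t => (f t : ℂ)) := by
    rintro f ⟨M, hM⟩
    exact ⟨M, fun t ht => by rw [Complex.norm_real]; exact hM t ht⟩
  have castB' : ∀ f : ℝ → ℝ, Bdd0 (fun t => (f t : ℂ)) → Bdd0 f := by
    rintro f ⟨M, hM⟩
    exact ⟨M, fun t ht => by rw [← Complex.norm_real]; exact hM t ht⟩
  have castT : ∀ (f : ℝ → ℝ) (l : ℝ), Tendsto f atTop (nhds l) →
      Tendsto (fun t => (f t : ℂ)) atTop (nhds (l : ℂ)) := fun f l h =>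
    (Complex.continuous_ofReal.tendsto l).comp h
  have castT' : ∀ (f : ℝ → ℝ) (l : ℝ), Tendsto (fun t => (f t : ℂ)) atTop (nhds (l : ℂ)) →
      Tendsto f atTop (nhds l) := fun f l h => by
    exact (Complex.continuous_re.tendsto (l : ℂ)).comp h
  have hzC : ∀ i t, 0 ≤ t → HasDerivAt (fun t => (z i t : ℂ)) (-(lam : ℂ) * (z i t : ℂ) + (sf i t : ℂ)) t := by
    intro i t ht
    refine ((hz' i t ht).ofReal_comp).congr_deriv ?_
    rw [hsdef i t]
    push_cast
    ring
  have bz : ∀ i, Bdd0 (z i) := fun i => castB' _ (ode_bdd hlamC (hzC i) (castB _ (bs i)))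
  -- matrix identities
  have hξL : ∀ i t, ξ i t = ∑ j, L i j * x j t := by
    intro i t
    rw [hξdef]
    have h1 : ∀ j, L i j * x j t = (if i = j then (∑ p, a i p) * x j t else 0) - a i j * x j t := by
      intro j
      rw [hLdef]
      split_ifs with h
      · subst h; rw [hadiag]; ring
      · ring
    simp only [h1, Finset.sum_sub_distrib, mul_sub, Finset.sum_ite_eq, Finset.mem_univ, if_true,
      Finset.sum_mul]
  have hVL : ∀ k j, ∑ i, V i k * (L i j : ℂ) = ∑ m, D k m * V j m := by
    have : Vᵀ * L.map Complex.ofReal = D * Vᵀ := by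
      rw [hLap.L_eq, Matrix.mul_assoc, ← Matrix.mul_assoc Vᵀ, hLap.VtU, Matrix.one_mul]
    intro k j
    have h := congrFun (congrFun this k) j
    simpa [Matrix.mul_apply] using h
  have hωL : ∀ j, ∑ i, ω i * L i j = 0 := by
    have : (fun i => (ω i : ℂ)) ᵥ* L.map Complex.ofReal = 0 := by
      rw [hLap.L_eq, Matrix.mul_assoc, ← Matrix.vecMul_vecMul, hLap.omega_U, Matrix.zero_vecMul]
    intro j
    have h := congrFun this j
    simp only [Matrix.vecMul, dotProduct, Matrix.map_apply, Pi.zero_apply] at h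
    exact_mod_cast h
  have hωξ : ∀ t, ∑ i, ω i * ξ i t = 0 := by
    intro t
    simp only [hξL, Finset.mul_sum]
    rw [Finset.sum_comm]
    apply Finset.sum_eq_zero
    intro j _
    have := hωL j
    calc ∑ i, ω i * (L i j * x j t) = (∑ i, ω i * L i j) * x j t := by
          rw [Finset.sum_mul]; exact Finset.sum_congr rfl fun i _ => by ring
      _ = 0 := by rw [this, zero_mul]
  have hωx : ∀ t, ∑ i, ω i * x i t = ∑ i, ω i * z i t + ∑ i, ω i * xbar i := by
    intro t
    have h1 : ∑ i, ω i * ∫ s in (0:ℝ)..t, ξ i s = 0 := by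
      simp only [← intervalIntegral.integral_const_mul]
      rw [← intervalIntegral.integral_finsetSum]
      · simp [hωξ]
      · intro i _
        exact (continuous_const.mul (hξc i)).intervalIntegrable _ _
    have h2 : ∑ i, ω i * z i t = ∑ i, ω i * x i t - ∑ i, ω i * xbar i
        + ρ * ∑ i, ω i * ∫ s in (0:ℝ)..t, ξ i s := by
      rw [Finset.mul_sum, ← Finset.sum_sub_distrib, ← Finset.sum_add_distrib]
      apply Finset.sum_congr rfl
      intro i _
      rw [hzdef]; ring
    rw [h2, h1]; ring
  set y : Fin (N - 1) → ℝ → ℂ := fun k t => ∑ i, V i k * (x i t : ℂ) with hy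
  set f : Fin (N - 1) → ℝ → ℂ := fun k t => ∑ i, V i k * ((sf i t - lam * z i t : ℝ) : ℂ) with hf
  have hxrec : ∀ i t, (x i t : ℂ) = ∑ k, U i k * y k t +
      ((∑ j, ω j * z j t + ∑ j, ω j * xbar j : ℝ) : ℂ) := by
    intro i t
    rw [← hωx]
    have h := congrArg (fun M => (M *ᵥ (fun j => (x j t : ℂ))) i) hLap.UVt
    simp only [Matrix.add_mulVec, Matrix.one_mulVec, Pi.add_apply, ← Matrix.mulVec_mulVec] at h
    rw [← h]
    simp [Matrix.mulVec, dotProduct, hy]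
  have hy' : ∀ k t, 0 ≤ t → HasDerivAt (y k) (-(∑ m, ((ρ : ℂ) • D) k m * y m t) + f k t) t := by
    intro k t ht
    have h1 : HasDerivAt (y k) (∑ i, V i k * (v i t : ℂ)) t := by
      apply HasDerivAt.fun_sum
      intro i _
      exact ((hdyn1 i t ht).ofReal_comp).const_mul _
    refine h1.congr_deriv ?_
    have h2 : ∑ m, ((ρ : ℂ) • D) k m * y m t = ρ * ∑ i, V i k * (ξ i t : ℂ) := by
      have e1 : ∑ i, V i k * (ξ i t : ℂ) = ∑ j, (∑ i, V i k * (L i j : ℂ)) * x j t := by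
        simp only [hξL, Complex.ofReal_sum, Complex.ofReal_mul, Finset.mul_sum, Finset.sum_mul]
        rw [Finset.sum_comm]
        exact Finset.sum_congr rfl fun j _ => Finset.sum_congr rfl fun i _ => by ring
      rw [e1]
      simp only [hVL, hy, Matrix.smul_apply, smul_eq_mul, Finset.mul_sum, Finset.sum_mul]
      rw [Finset.sum_comm]
      exact Finset.sum_congr rfl fun j _ => Finset.sum_congr rfl fun i _ => by ring
    rw [h2, hf, Finset.mul_sum, ← Finset.sum_neg_distrib, ← Finset.sum_add_distrib]
    apply Finset.sum_congr rfl
    intro i _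
    rw [hsdef i t]
    push_cast
    ring
  have htri := tri_bdd (D := (ρ : ℂ) • D) (by
      intro i j hij; simp [hLap.D_upper i j hij]) (by
      intro i; simpa using mul_pos hρ (hLap.D_diag_pos i)) hy'
  have bf : ∀ k, Bdd0 (f k) := fun k => Bdd0.sum _ fun i _ => (Bdd0.const _).mul
    (castB _ ((bs i).sub ((Bdd0.const lam).mul (bz i))))
  have by' := htri.1 bf
  have bx : ∀ i, Bdd0 (x i) := by
    intro i
    apply castB'
    simp only [hxrec]
    exact (Bdd0.sum _ fun k _ => (Bdd0.const _).mul (by' k)).add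
      (castB _ ((Bdd0.sum _ fun j _ => (Bdd0.const _).mul (bz j)).add (Bdd0.const _)))
  have bξ : ∀ i, Bdd0 (ξ i) := by
    intro i
    have : ξ i = fun t => ∑ j, a i j * (x i t - x j t) := funext (hξdef i)
    rw [this]
    exact Bdd0.sum _ fun j _ => (Bdd0.const _).mul ((bx i).sub (bx j))
  have hveq : ∀ i t, v i t = sf i t - lam * z i t - ρ * ξ i t := by
    intro i t; rw [hsdef]; ring
  have bv : ∀ i, Bdd0 (v i) := by
    intro i
    have : v i = fun t => sf i t - lam * z i t - ρ * ξ i t := funext (hveq i)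
    rw [this]
    exact ((bs i).sub ((Bdd0.const _).mul (bz i))).sub ((Bdd0.const _).mul (bξ i))
  have bφ : ∀ i p, Bdd0 (fun t => φ i (x i t) (v i t) p) := by
    intro i p
    obtain ⟨A, hA⟩ := bx i
    obtain ⟨B, hB⟩ := bv i
    have hc : ContinuousOn (fun q : ℝ × ℝ => φ i q.1 q.2) (Set.Icc (-A) A ×ˢ Set.Icc (-B) B) :=
      (hφ i).continuous.continuousOn
    obtain ⟨M, hM⟩ := (isCompact_Icc.prod isCompact_Icc).exists_bound_of_continuousOn hc
    refine ⟨M, fun t ht => (norm_le_pi_norm (φ i (x i t) (v i t)) p).trans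
      (hM (x i t, v i t) ⟨abs_le.1 (hA t ht), abs_le.1 (hB t ht)⟩)⟩
  have bcongr : ∀ f g : ℝ → ℝ, (∀ t, 0 ≤ t → f t = g t) → Bdd0 g → Bdd0 f := by
    rintro f g h ⟨M, hM⟩
    exact ⟨M, fun t ht => by rw [h t ht]; exact hM t ht⟩
  have bdv : ∀ i, Bdd0 (fun t => ∑ j, a i j * (v i t - v j t)) := fun i =>
    Bdd0.sum _ fun j _ => (Bdd0.const _).mul ((bv i).sub (bv j))
  have bdx : ∀ i, Bdd0 (fun t => ∑ j, a i j * (x i t - x j t)) := fun i =>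
    Bdd0.sum _ fun j _ => (Bdd0.const _).mul ((bx i).sub (bx j))
  have bu : ∀ i, Bdd0 (u i) := by
    intro i
    refine bcongr _ _ (hctrl i) ?_
    have hcos : Bdd0 (fun t => Real.cos (ζ i t)) := ⟨1, fun t _ => Real.abs_cos_le_one _⟩
    have hsq : Bdd0 (fun t => (ζ i t) ^ 2) := by simpa [sq] using (bζ i).mul (bζ i)
    refine (hsq.mul hcos).mul (((((Bdd0.sum _ fun p _ => (bθ i p).mul (bφ i p)).add
      ((Bdd0.const _).mul (bv i))).add ((Bdd0.const _).mul (bdv i))).add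
      ((Bdd0.const _).mul (bs i))).add ((Bdd0.const _).mul (bdx i)))
  have bs' : ∀ i, Bdd0 (fun t => (b i * u i t + ∑ p, θ i p * φ i (x i t) (v i t) p)
      + ρ * (∑ j, a i j * (v i t - v j t)) + lam * (v i t + ρ * ξ i t)) := fun i =>
    (((((Bdd0.const _).mul (bu i)).add (Bdd0.sum _ fun p _ => (Bdd0.const _).mul (bφ i p))).add
      ((Bdd0.const _).mul (bdv i))).add
      ((Bdd0.const _).mul ((bv i).add ((Bdd0.const _).mul (bξ i)))))
  have ts : ∀ i, Tendsto (sf i) atTop (nhds 0) := by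
    intro i
    obtain ⟨F, l, hF, hl⟩ := (hagent i).2.2.2
    obtain ⟨K, hK⟩ := (Bdd0.const ν).mul ((Bdd0.const 2).mul ((bs i).mul (bs' i)))
    have hg : ∀ t, 0 ≤ t → HasDerivAt (fun t => ν * (sf i t) ^ 2) _ t := fun t ht =>
      ((hs' i t ht).pow 2).const_mul ν
    have hlip : ∀ p q, 0 ≤ p → p ≤ q →
        |ν * (sf i p) ^ 2 - ν * (sf i q) ^ 2| ≤ K * (q - p) := by
      intro p q hp hpq
      have := (convex_Ici (0:ℝ)).norm_image_sub_le_of_norm_hasDerivWithin_le (C := K)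
        (fun t ht => (hg t ht).hasDerivWithinAt) (fun t ht => by
          refine le_trans (le_of_eq ?_) (hK t ht)
          congr 1
          push_cast
          ring) (Set.mem_Ici.2 hp) (Set.mem_Ici.2 (hp.trans hpq))
      rw [abs_sub_comm]
      rw [Real.norm_eq_abs, Real.norm_eq_abs, abs_of_nonneg (show 0 ≤ q - p by linarith)] at this
      exact this
    have h0 := barbalat_aux hF hlip hl
    have h1 : Tendsto (fun t => (sf i t) ^ 2) atTop (nhds 0) := by
      have := h0.const_mul ν⁻¹
      simpa [← mul_assoc, inv_mul_cancel₀ hν.ne'] using this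
    have h2 := (Real.continuous_sqrt.tendsto 0).comp h1
    simp only [Real.sqrt_zero] at h2
    rw [tendsto_zero_iff_abs_tendsto_zero]
    refine h2.congr fun t => ?_
    simp [Real.sqrt_sq_eq_abs]
  have tz : ∀ i, Tendsto (z i) atTop (nhds 0) := fun i => castT' _ _ (by
    simpa using ode_tendsto hlamC (hzC i) (by simpa using castT _ _ (ts i)))
  have tf : ∀ k, Tendsto (f k) atTop (nhds 0) := by
    intro k
    rw [show (0:ℂ) = ∑ i, V i k * ((0 - lam * 0 : ℝ) : ℂ) by simp]
    exact tendsto_finsetSum _ fun i _ => (castT _ _ ((ts i).sub ((tz i).const_mul lam))).const_mul _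
  have ty := htri.2 tf
  have tx : ∀ i, Tendsto (fun t : ℝ => x i t) atTop (nhds (∑ j, ω j * xbar j)) := by
    intro i
    apply castT'
    simp only [hxrec]
    rw [show ((∑ j, ω j * xbar j : ℝ) : ℂ) = ∑ k, U i k * 0 +
      ((∑ j, ω j * 0 + ∑ j, ω j * xbar j : ℝ) : ℂ) by simp]
    exact (tendsto_finsetSum _ fun k _ => (ty k).const_mul _).add (castT _ _
      ((tendsto_finsetSum _ fun j _ => (tz j).const_mul _).add tendsto_const_nhds))
  have txx : ∀ i j : Fin N, Tendsto (fun t : ℝ => x i t - x j t) atTop (nhds 0) := by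
    intro i j
    simpa using (tx i).sub (tx j)
  have tv : ∀ i : Fin N, Tendsto (fun t : ℝ => v i t) atTop (nhds 0) := by
    intro i
    simp only [hveq, hξdef]
    rw [show (0:ℝ) = 0 - lam * 0 - ρ * ∑ j, a i j * 0 by simp]
    exact ((ts i).sub ((tz i).const_mul _)).sub
      ((tendsto_finsetSum _ fun j _ => (txx i j).const_mul _).const_mul _)
  refine ⟨?_, txx, fun i j => by simpa using (tv i).sub (tv j), tx, tv⟩
  choose A1 h1 using bx
  choose A2 h2 using bv
  choose A3 h3 using bz
  choose A4 h4 using bs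
  choose A5 h5 using bθ
  choose A6 h6 using bζ
  choose A7 h7 using bu
  set B : Fin N → ℝ := fun i => |A1 i| + |A2 i| + |A3 i| + |A4 i| + (∑ p, |A5 i p|) + |A6 i| + |A7 i|
    with hB
  refine ⟨∑ i, B i, fun i t ht => ?_⟩
  have hBnn : ∀ i, 0 ≤ B i := fun i => by simp only [hB]; positivity
  have hBi : B i ≤ ∑ i, B i := Finset.single_le_sum (fun j _ => hBnn j) (Finset.mem_univ i)
  have hBe : B i = |A1 i| + |A2 i| + |A3 i| + |A4 i| + (∑ p, |A5 i p|) + |A6 i| + |A7 i| := rfl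
  have h5n : 0 ≤ ∑ p, |A5 i p| := Finset.sum_nonneg fun _ _ => abs_nonneg _
  have h5' : ‖θh i t‖ ≤ ∑ p, |A5 i p| := by
    rw [pi_norm_le_iff_of_nonneg h5n]
    intro p
    exact ((h5 i p t ht).trans (le_abs_self _)).trans
      (Finset.single_le_sum (f := fun p => |A5 i p|) (fun _ _ => abs_nonneg _) (Finset.mem_univ p))
  have g1 := (h1 i t ht).trans (le_abs_self _)
  have g2 := (h2 i t ht).trans (le_abs_self _)
  have g3 := (h3 i t ht).trans (le_abs_self _)
  have g4 := (h4 i t ht).trans (le_abs_self _)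
  have g6 := (h6 i t ht).trans (le_abs_self _)
  have g7 := (h7 i t ht).trans (le_abs_self _)
  rw [Real.norm_eq_abs] at g1 g2 g3 g4 g6 g7
  have n1 := abs_nonneg (A1 i)
  have n2 := abs_nonneg (A2 i)
  have n3 := abs_nonneg (A3 i)
  have n4 := abs_nonneg (A4 i)
  have n6 := abs_nonneg (A6 i)
  have n7 := abs_nonneg (A7 i)
  refine ⟨?_, ?_, ?_, ?_, ?_, ?_, ?_⟩ <;> linarith
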